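/- arXiv:1811.01350 — 2 statements merged into one kernel-verified Lean document; each statement's English description precedes it below -/
import Mathlib

section
/- Let δ₀ > 0, Γ > 0, C > 0 and set T := δ₀/Γ. Let p̂ and R̂ associate to each t ∈ [0,T) coefficient families p̂(t), R̂(t) : ℤ^d → ℂ, with t ↦ p̂_k(t) and t ↦ R̂_n(t) continuous for every k, n ∈ ℤ^d. Assume: (a) for all t ∈ [0,T) and all δ ∈ [0, δ₀ − Γt), Σ_{k∈ℤ^d} |k|·|p̂_k(t)|·e^{δ|k|} ≤ C·(δ₀ − δ − Γt)^{−1/2}; (b) sup over t ∈ [0,T) and δ ∈ [0, δ₀ − Γt) of Σ_{n∈ℤ^d} |R̂_n(t)|·e^{δ|n|} is finite; (c) for all n ∈ ℤ^d and t ∈ [0,T), R̂_n(t) = −∫₀ᵗ ∫₀ˢ Σ_{k+l=n} (n·k)·p̂_k(τ)·R̂_l(τ) dτ ds (the inner sums converging absolutely). Then R̂_n(t) = 0 for every n ∈ ℤ^d and every t ∈ [0,T). -/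
open MeasureTheory ENNReal

noncomputable section

/-- Euclidean norm of an integer vector `n ∈ ℤ^d ⊂ ℝ^d`. -/
def znorm {d : ℕ} (n : Fin d → ℤ) : ℝ := Real.sqrt (∑ j, ((n j : ℝ)) ^ 2)

lemma znorm_nonneg {d : ℕ} (n : Fin d → ℤ) : 0 ≤ znorm n := Real.sqrt_nonneg _

lemma znorm_eq_norm {d : ℕ} (n : Fin d → ℤ) :
    znorm n = ‖WithLp.toLp 2 (fun j => (n j : ℝ))‖ := by
  simp [znorm, EuclideanSpace.norm_eq]

lemma znorm_le_add_sub {d : ℕ} (n k : Fin d → ℤ) : znorm n ≤ znorm k + znorm (n - k) := by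
  simp only [znorm_eq_norm]
  refine le_of_eq_of_le ?_ (norm_add_le _ _)
  congr 1
  ext j
  simp

lemma norm_dot_le_znorm_mul {d : ℕ} (n k : Fin d → ℤ) :
    ‖((∑ j, n j * k j : ℤ) : ℂ)‖ ≤ znorm n * znorm k := by
  have h := abs_real_inner_le_norm (WithLp.toLp 2 (fun j => (k j : ℝ)))
    (WithLp.toLp 2 (fun j => (n j : ℝ)))
  rw [← znorm_eq_norm, ← znorm_eq_norm, mul_comm (znorm k)] at h
  refine le_of_eq_of_le ?_ h
  rw [Complex.norm_intCast]
  simp [PiLp.inner_apply]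

/-- The weight `|n| e^{δ|n|}` is controlled by `ε⁻¹ e^{(δ+ε)|n|}`. -/
lemma znorm_mul_exp_le {d : ℕ} {δ ε : ℝ} (hδ : 0 ≤ δ) (hε : 0 < ε) (n k : Fin d → ℤ) :
    znorm n * Real.exp (δ * znorm n) ≤
      ε⁻¹ * (Real.exp ((δ + ε) * znorm k) * Real.exp ((δ + ε) * znorm (n - k))) := by
  have h₁ : znorm n ≤ ε⁻¹ * Real.exp (ε * znorm n) := by
    rw [inv_mul_eq_div, le_div_iff₀ hε]
    linarith [Real.add_one_le_exp (ε * znorm n)]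
  calc znorm n * Real.exp (δ * znorm n)
      ≤ ε⁻¹ * Real.exp (ε * znorm n) * Real.exp (δ * znorm n) := by gcongr
    _ = ε⁻¹ * Real.exp ((δ + ε) * znorm n) := by
        rw [mul_assoc, ← Real.exp_add]; ring_nf
    _ ≤ ε⁻¹ * Real.exp ((δ + ε) * (znorm k + znorm (n - k))) := by
        gcongr
        exact znorm_le_add_sub n k
    _ = _ := by rw [mul_add, Real.exp_add]

/-- Analytic-norm estimate for `div (∇p · R)`, at the cost of `ε` in the analyticity radius. -/
lemma tsum_enorm_conv_le {d : ℕ} {δ ε : ℝ} (hδ : 0 ≤ δ) (hε : 0 < ε) (p R : (Fin d → ℤ) → ℂ) :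
    ∑' n : Fin d → ℤ, ‖∑' k : Fin d → ℤ, ((∑ j, n j * k j : ℤ) : ℂ) * p k * R (n - k)‖ₑ *
        ENNReal.ofReal (Real.exp (δ * znorm n)) ≤
      ENNReal.ofReal ε⁻¹ *
        ((∑' k : Fin d → ℤ, ENNReal.ofReal (znorm k) * ‖p k‖ₑ *
            ENNReal.ofReal (Real.exp ((δ + ε) * znorm k))) *
          ∑' n : Fin d → ℤ, ‖R n‖ₑ * ENNReal.ofReal (Real.exp ((δ + ε) * znorm n))) := by
  set a : (Fin d → ℤ) → ℝ≥0∞ := fun k => ENNReal.ofReal (znorm k) * ‖p k‖ₑ *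
    ENNReal.ofReal (Real.exp ((δ + ε) * znorm k))
  set b : (Fin d → ℤ) → ℝ≥0∞ := fun n => ‖R n‖ₑ * ENNReal.ofReal (Real.exp ((δ + ε) * znorm n))
  have hterm (n k : Fin d → ℤ) : ‖((∑ j, n j * k j : ℤ) : ℂ) * p k * R (n - k)‖ₑ *
      ENNReal.ofReal (Real.exp (δ * znorm n)) ≤ ENNReal.ofReal ε⁻¹ * (a k * b (n - k)) := by
    simp only [a, b, ← ofReal_norm]
    have hn := znorm_nonneg n
    have hk := znorm_nonneg k
    rw [← ENNReal.ofReal_mul (by positivity), ← ENNReal.ofReal_mul (by positivity),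
      ← ENNReal.ofReal_mul (by positivity), ← ENNReal.ofReal_mul (by positivity),
      ← ENNReal.ofReal_mul (by positivity), ← ENNReal.ofReal_mul (by positivity)]
    apply ENNReal.ofReal_le_ofReal
    rw [norm_mul, norm_mul]
    calc _ ≤ znorm n * znorm k * ‖p k‖ * ‖R (n - k)‖ * Real.exp (δ * znorm n) := by
          gcongr
          exact norm_dot_le_znorm_mul n k
      _ = znorm k * ‖p k‖ * ‖R (n - k)‖ * (znorm n * Real.exp (δ * znorm n)) := by ring
      _ ≤ znorm k * ‖p k‖ * ‖R (n - k)‖ *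
          (ε⁻¹ * (Real.exp ((δ + ε) * znorm k) * Real.exp ((δ + ε) * znorm (n - k)))) :=
          mul_le_mul_of_nonneg_left (znorm_mul_exp_le hδ hε n k) (by positivity)
      _ = _ := by ring
  calc _ ≤ ∑' n : Fin d → ℤ, ∑' k : Fin d → ℤ, ENNReal.ofReal ε⁻¹ * (a k * b (n - k)) := by
        refine ENNReal.tsum_le_tsum fun n => ?_
        refine (mul_le_mul_left enorm_tsum_le_tsum_enorm _).trans ?_
        rw [← ENNReal.tsum_mul_right]
        exact ENNReal.tsum_le_tsum (hterm n)
    _ = ENNReal.ofReal ε⁻¹ * ∑' k : Fin d → ℤ, ∑' n : Fin d → ℤ, a k * b (n - k) := by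
        simp_rw [ENNReal.tsum_mul_left]
        rw [ENNReal.tsum_comm]
        simp_rw [ENNReal.tsum_mul_left]
    _ = _ := by
        have hshift (k : Fin d → ℤ) : ∑' n, b (n - k) = ∑' n, b n :=
          (Equiv.subRight k).tsum_eq b
        simp_rw [ENNReal.tsum_mul_left, hshift]
        rw [ENNReal.tsum_mul_right]

lemma tsum_lintegral_le_lintegral_tsum {α ι : Type*} [MeasurableSpace α] (μ : Measure α)
    (f : ι → α → ℝ≥0∞) : ∑' i, ∫⁻ x, f i x ∂μ ≤ ∫⁻ x, ∑' i, f i x ∂μ := by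
  classical
  refine ENNReal.summable.tsum_le_of_sum_le fun s => ?_
  have hs : ∑ i ∈ s, ∫⁻ x, f i x ∂μ ≤ ∫⁻ x, ∑ i ∈ s, f i x ∂μ := by
    induction s using Finset.induction_on with
    | empty => simp
    | insert i s hi ih =>
      simp_rw [Finset.sum_insert hi]
      exact (add_le_add_right ih _).trans (le_lintegral_add _ _)
  exact hs.trans (lintegral_mono fun x => ENNReal.sum_le_tsum s)

/-- Triangle inequality for a weighted `ℓ¹` norm of a double time integral. -/
lemma tsum_enorm_double_integral_le {ι : Type*} {t : ℝ} (ht : 0 ≤ t) (F : ι → ℝ → ℂ)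
    (w : ι → ℝ≥0∞) (hw : ∀ i, w i ≠ ∞) :
    ∑' i, ‖-∫ s in (0 : ℝ)..t, ∫ τ in (0 : ℝ)..s, F i τ‖ₑ * w i ≤
      ∫⁻ s in Set.Ioc 0 t, ∫⁻ τ in Set.Ioc 0 s, ∑' i, ‖F i τ‖ₑ * w i := by
  have h (i : ι) : ‖-∫ s in (0 : ℝ)..t, ∫ τ in (0 : ℝ)..s, F i τ‖ₑ * w i ≤
      ∫⁻ s in Set.Ioc 0 t, ∫⁻ τ in Set.Ioc 0 s, ‖F i τ‖ₑ * w i := by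
    simp_rw [lintegral_mul_const' _ _ (hw i)]
    gcongr
    rw [enorm_neg, intervalIntegral.integral_of_le ht]
    refine (enorm_integral_le_lintegral_enorm _).trans ?_
    refine setLIntegral_mono' measurableSet_Ioc fun s hs => ?_
    rw [intervalIntegral.integral_of_le hs.1.le]
    exact enorm_integral_le_lintegral_enorm _
  refine (ENNReal.tsum_le_tsum h).trans ((tsum_lintegral_le_lintegral_tsum _ _).trans ?_)
  exact lintegral_mono fun s => tsum_lintegral_le_lintegral_tsum _ _

lemma lintegral_Ico_sub_rpow {a s : ℝ} (h : a ≤ s) :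
    ∫⁻ τ in Set.Ico a s, ENNReal.ofReal ((s - τ) ^ (-(3 / 4) : ℝ)) =
      ENNReal.ofReal (4 * (s - a) ^ (1 / 4 : ℝ)) := by
  have hint : IntervalIntegrable (fun τ : ℝ => (s - τ) ^ (-(3 / 4) : ℝ)) volume a s := by
    have := (intervalIntegral.intervalIntegrable_rpow' (a := s - a) (b := 0)
      (r := -(3 / 4)) (by norm_num)).comp_sub_left s
    simpa using this
  rw [setLIntegral_congr Ico_ae_eq_Ioc, ← ofReal_integral_eq_lintegral_ofReal]
  · rw [← intervalIntegral.integral_of_le h,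
      intervalIntegral.integral_comp_sub_left (fun x : ℝ => x ^ (-(3 / 4) : ℝ)) s,
      integral_rpow (Or.inl (by norm_num))]
    congr 1
    norm_num
    ring
  · exact (intervalIntegrable_iff_integrableOn_Ioc_of_le h).1 hint
  · refine (ae_restrict_iff' measurableSet_Ioc).2 (Filter.Eventually.of_forall fun τ hτ => ?_)
    exact Real.rpow_nonneg (sub_nonneg.2 hτ.2) _

lemma setLIntegral_le_of_le_sub_rpow {a s : ℝ} (h : a ≤ s) {g : ℝ → ℝ≥0∞} {K : ℝ≥0∞}
    (hK : K ≠ ∞) (h₀ : ∀ τ ∈ Set.Ioo 0 s, τ < a → g τ = 0)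
    (h₁ : ∀ τ ∈ Set.Ioo 0 s, a ≤ τ → g τ ≤ ENNReal.ofReal ((s - τ) ^ (-(3 / 4) : ℝ)) * K) :
    ∫⁻ τ in Set.Ioc 0 s, g τ ≤ ENNReal.ofReal (4 * (s - a) ^ (1 / 4 : ℝ)) * K := by
  rw [← lintegral_Ico_sub_rpow h, ← lintegral_mul_const' _ _ hK,
    ← setLIntegral_congr (Ioo_ae_eq_Ioc (a := (0 : ℝ)) (b := s)),
    ← lintegral_indicator measurableSet_Ico]
  refine (setLIntegral_mono' measurableSet_Ioo fun τ hτ => ?_).trans (setLIntegral_le_lintegral _ _)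
  rcases lt_or_ge τ a with hlt | hge
  · simp [h₀ τ hτ hlt]
  · rw [Set.indicator_of_mem (show τ ∈ Set.Ico a s from ⟨hge, hτ.2⟩)]
    exact h₁ τ hτ hge

/-- Double integration of a kernel with singularity `(s - τ)^{-3/4} (t - s)^{-3/4}`. -/
lemma double_lintegral_le {a t q c : ℝ} (hat : a ≤ t) (hc : 0 ≤ c) (hq : 0 ≤ q)
    (htq : t - a ≤ q ^ 4) {g : ℝ → ℝ≥0∞} {M : ℝ≥0∞} (hM : M ≠ ∞)
    (h₀ : ∀ τ ∈ Set.Ioo 0 t, τ < a → g τ = 0)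
    (h₁ : ∀ s ∈ Set.Ioo 0 t, ∀ τ ∈ Set.Ioo 0 s, a ≤ τ → g τ ≤
      ENNReal.ofReal (c * ((s - τ) ^ (-(3 / 4) : ℝ) * (t - s) ^ (-(3 / 4) : ℝ))) * M) :
    ∫⁻ s in Set.Ioc 0 t, ∫⁻ τ in Set.Ioc 0 s, g τ ≤ ENNReal.ofReal (16 * c * q ^ 2) * M := by
  have hroot {s : ℝ} (hs : a ≤ s) (hst : s ≤ t) : (s - a) ^ (1 / 4 : ℝ) ≤ q := by
    calc (s - a) ^ (1 / 4 : ℝ) ≤ (q ^ 4) ^ (1 / 4 : ℝ) :=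
          Real.rpow_le_rpow (by linarith) (by linarith) (by norm_num)
      _ = q := by
          rw [← Real.rpow_natCast, ← Real.rpow_mul hq]
          norm_num
  refine (setLIntegral_le_of_le_sub_rpow hat (K := ENNReal.ofReal (4 * q * c) * M)
    (ENNReal.mul_ne_top ENNReal.ofReal_ne_top hM) ?_ ?_).trans ?_
  · intro s hs hsa
    refine setLIntegral_eq_zero measurableSet_Ioc fun τ hτ => ?_
    exact h₀ τ ⟨hτ.1, hτ.2.trans_lt hs.2⟩ (hτ.2.trans_lt hsa)
  · intro s hs has
    have hpos : 0 ≤ (t - s) ^ (-(3 / 4) : ℝ) := Real.rpow_nonneg (by linarith [hs.2]) _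
    refine (setLIntegral_le_of_le_sub_rpow has
      (K := ENNReal.ofReal (c * (t - s) ^ (-(3 / 4) : ℝ)) * M)
      (ENNReal.mul_ne_top ENNReal.ofReal_ne_top hM) ?_ ?_).trans ?_
    · exact fun τ hτ => h₀ τ ⟨hτ.1, hτ.2.trans hs.2⟩
    · intro τ hτ haτ
      refine (h₁ s hs τ hτ haτ).trans_eq ?_
      rw [← mul_assoc (ENNReal.ofReal _),
        ← ENNReal.ofReal_mul (Real.rpow_nonneg (sub_nonneg.2 hτ.2.le) _)]
      ring_nf
    · have hsa : 0 ≤ (s - a) ^ (1 / 4 : ℝ) := Real.rpow_nonneg (by linarith) _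
      rw [← mul_assoc, ← mul_assoc, ← ENNReal.ofReal_mul (by positivity),
        ← ENNReal.ofReal_mul hpos]
      gcongr ENNReal.ofReal ?_ * M
      have := mul_le_mul_of_nonneg_right (hroot has hs.2.le) (mul_nonneg hc hpos)
      linarith
  · have hta : 0 ≤ (t - a) ^ (1 / 4 : ℝ) := Real.rpow_nonneg (by linarith) _
    rw [← mul_assoc, ← ENNReal.ofReal_mul (by positivity)]
    gcongr ENNReal.ofReal ?_ * M
    have := mul_le_mul_of_nonneg_right (hroot hat le_rfl) (mul_nonneg hq hc)
    linarith

lemma rpow_mul_rpow_le_of_add_le {x y z : ℝ} (hx : 0 < x) (hy : 0 < y) (hz : x + y ≤ z) :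
    (z * √z)⁻¹ ≤ x ^ (-(3 / 4) : ℝ) * y ^ (-(3 / 4) : ℝ) := by
  have hz0 : 0 < z := by linarith
  have : (z * √z)⁻¹ = z ^ (-(3 / 4) : ℝ) * z ^ (-(3 / 4) : ℝ) := by
    rw [Real.sqrt_eq_rpow, ← Real.rpow_one_add' hz0.le (by norm_num), ← Real.rpow_neg hz0.le,
      ← Real.rpow_add hz0]
    norm_num
  rw [this]
  exact mul_le_mul (Real.rpow_le_rpow_of_nonpos hx (by linarith) (by norm_num))
    (Real.rpow_le_rpow_of_nonpos hy (by linarith) (by norm_num)) (by positivity) (by positivity)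

/-- The singular coefficient produced by halving the remaining analyticity radius `r`. -/
lemma inv_mul_div_sqrt_le {Γ C r x y : ℝ} (hΓ : 0 < Γ) (hC : 0 < C) (hx : 0 < x) (hy : 0 < y)
    (hr : Γ * (x + y) ≤ r) :
    (r / 2)⁻¹ * (C / √(r / 2)) ≤
      C * ((Γ / 2) * √(Γ / 2))⁻¹ * (x ^ (-(3 / 4) : ℝ) * y ^ (-(3 / 4) : ℝ)) := by
  have hle : Γ / 2 * (x + y) ≤ r / 2 := by linarith
  have hr0 : 0 ≤ r / 2 := le_trans (by positivity) hle
  calc (r / 2)⁻¹ * (C / √(r / 2)) = C * ((r / 2) * √(r / 2))⁻¹ := by rw [mul_inv]; ring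
    _ ≤ C * ((Γ / 2 * (x + y)) * √(Γ / 2 * (x + y)))⁻¹ := by gcongr
    _ = C * ((Γ / 2) * √(Γ / 2))⁻¹ * ((x + y) * √(x + y))⁻¹ := by
        rw [Real.sqrt_mul (by positivity)]
        simp only [mul_inv]
        ring
    _ ≤ _ := by
        gcongr
        exact rpow_mul_rpow_le_of_add_le hx hy le_rfl

/-- If `R` vanishes before time `a`, it vanishes on a further time interval whose length
depends only on `C` and `Γ`. -/
lemma eq_zero_of_lt_add {d : ℕ} {δ₀ Γ C q : ℝ} (hΓ : 0 < Γ) (hC : 0 < C) (hq : 0 ≤ q)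
    (hqC : 16 * (C * ((Γ / 2) * √(Γ / 2))⁻¹) * q ^ 2 ≤ 1 / 2)
    (phat Rhat : ℝ → (Fin d → ℤ) → ℂ)
    (ha : ∀ t ∈ Set.Ico (0 : ℝ) (δ₀ / Γ), ∀ δ ∈ Set.Ico (0 : ℝ) (δ₀ - Γ * t),
      ∑' k : Fin d → ℤ, ENNReal.ofReal (znorm k) * ‖phat t k‖ₑ *
        ENNReal.ofReal (Real.exp (δ * znorm k)) ≤ ENNReal.ofReal (C / √(δ₀ - δ - Γ * t)))
    {B : ℝ} (hb : ∀ t ∈ Set.Ico (0 : ℝ) (δ₀ / Γ), ∀ δ ∈ Set.Ico (0 : ℝ) (δ₀ - Γ * t),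
      ∑' n : Fin d → ℤ, ‖Rhat t n‖ₑ * ENNReal.ofReal (Real.exp (δ * znorm n))
        ≤ ENNReal.ofReal B)
    (hc : ∀ n : Fin d → ℤ, ∀ t ∈ Set.Ico (0 : ℝ) (δ₀ / Γ),
      Rhat t n = -∫ s in (0 : ℝ)..t, ∫ τ in (0 : ℝ)..s,
        ∑' k : Fin d → ℤ, (((∑ j, n j * k j : ℤ)) : ℂ) * phat τ k * Rhat τ (n - k))
    {a : ℝ} (hzero : ∀ t ∈ Set.Ico (0 : ℝ) (δ₀ / Γ), t < a → ∀ n, Rhat t n = 0) :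
    ∀ t ∈ Set.Ico (0 : ℝ) (δ₀ / Γ), t < a + q ^ 4 → ∀ n, Rhat t n = 0 := by
  set H : ℝ → ℝ → ℝ≥0∞ := fun t δ =>
    ∑' n : Fin d → ℤ, ‖Rhat t n‖ₑ * ENNReal.ofReal (Real.exp (δ * znorm n)) with hH
  set S : Set (ℝ × ℝ) := {x | x.1 ∈ Set.Ico (0 : ℝ) (δ₀ / Γ) ∧ x.1 < a + q ^ 4 ∧
    x.2 ∈ Set.Ico (0 : ℝ) (δ₀ - Γ * x.1)}
  set M : ℝ≥0∞ := ⨆ x ∈ S, H x.1 x.2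
  have hle : ∀ {t δ : ℝ}, (t, δ) ∈ S → H t δ ≤ M := fun {t δ} h =>
    le_iSup₂_of_le (f := fun x (_ : x ∈ S) => H x.1 x.2) (t, δ) h le_rfl
  have hM : M ≠ ∞ := ne_top_of_le_ne_top ENNReal.ofReal_ne_top
    (iSup₂_le fun x hx => hb x.1 hx.1 x.2 hx.2.2)
  have hhalf : M ≤ ENNReal.ofReal (1 / 2) * M := by
    refine iSup₂_le ?_
    rintro ⟨t, δ⟩ ⟨ht, hta, hδ⟩
    dsimp only at ht hta hδ ⊢
    rcases lt_or_ge t a with hlt | hat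
    · simp [hH, hzero t ht hlt]
    have hHt : H t δ ≤ ∫⁻ s in Set.Ioc 0 t, ∫⁻ τ in Set.Ioc 0 s, ∑' n : Fin d → ℤ,
        ‖∑' k : Fin d → ℤ, ((∑ j, n j * k j : ℤ) : ℂ) * phat τ k * Rhat τ (n - k)‖ₑ *
          ENNReal.ofReal (Real.exp (δ * znorm n)) := by
      refine le_of_eq_of_le ?_ (tsum_enorm_double_integral_le ht.1 _ _
        fun n => ENNReal.ofReal_ne_top)
      exact tsum_congr fun n => by rw [← hc n t ht]
    refine hHt.trans ((double_lintegral_le hat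
      (c := C * ((Γ / 2) * √(Γ / 2))⁻¹) (by positivity) hq (by linarith) hM ?_ ?_).trans ?_)
    · intro τ hτ hτa
      simp [hzero τ ⟨hτ.1.le, hτ.2.trans ht.2⟩ hτa]
    · intro s hs τ hτ _
      have hτT : τ ∈ Set.Ico (0 : ℝ) (δ₀ / Γ) := ⟨hτ.1.le, (hτ.2.trans hs.2).trans ht.2⟩
      set r : ℝ := δ₀ - δ - Γ * τ with hr
      have hrle : Γ * ((s - τ) + (t - s)) ≤ r := by
        have := hδ.2
        rw [hr]
        linarith
      have hr0 : 0 < r := lt_of_lt_of_le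
        (mul_pos hΓ (by linarith [hτ.2, hs.2])) hrle
      have hδ' : δ + r / 2 ∈ Set.Ico (0 : ℝ) (δ₀ - Γ * τ) :=
        ⟨by linarith [hδ.1], by linarith⟩
      refine (tsum_enorm_conv_le hδ.1 (half_pos hr0) _ _).trans ?_
      have hp := ha τ hτT _ hδ'
      rw [show δ₀ - (δ + r / 2) - Γ * τ = r / 2 by linarith] at hp
      have hR : H τ (δ + r / 2) ≤ M := hle ⟨hτT, by linarith [hτ.2, hs.2], hδ'⟩
      refine (mul_le_mul_right (mul_le_mul' hp hR) _).trans ?_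
      rw [← mul_assoc, ← ENNReal.ofReal_mul (by positivity)]
      gcongr ENNReal.ofReal ?_ * M
      exact inv_mul_div_sqrt_le hΓ hC (sub_pos.2 hτ.2) (sub_pos.2 hs.2) hrle
    · gcongr
  have hM0 : M = 0 := by
    by_contra hne
    refine hhalf.not_gt ?_
    calc ENNReal.ofReal (1 / 2) * M < 1 * M :=
          ENNReal.mul_lt_mul_left hne hM (by rw [ENNReal.ofReal_lt_one]; norm_num)
      _ = M := one_mul M
  intro t ht hta n
  have hmem : (t, (0 : ℝ)) ∈ S := by
    refine ⟨ht, hta, le_rfl, ?_⟩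
    have := (lt_div_iff₀ hΓ).1 ht.2
    linarith
  have hz : H t 0 = 0 := le_antisymm ((hle hmem).trans_eq hM0) zero_le
  simpa using ENNReal.tsum_eq_zero.1 hz n

/-- Uniqueness for the second-order continuity equation
`∂ₜₜ R + div(-∇p · R) = 0` in analytic regularity, in Fourier coefficients:
if the pressure satisfies the analytic bound `(a)`, the solution has uniformly
bounded analytic norms `(b)`, and the Duhamel identity `(c)` holds (with zero
initial data `R(0) = ∂ₜR(0) = 0` built in), then `R ≡ 0` on `[0, δ₀/Γ)`. -/
theorem stmt_18 (d : ℕ) (δ₀ Γ C : ℝ) (hδ₀ : 0 < δ₀) (hΓ : 0 < Γ) (hC : 0 < C)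
    (phat Rhat : ℝ → (Fin d → ℤ) → ℂ)
    (hpc : ∀ k : Fin d → ℤ, ContinuousOn (fun t => phat t k) (Set.Ico 0 (δ₀ / Γ)))
    (hRc : ∀ n : Fin d → ℤ, ContinuousOn (fun t => Rhat t n) (Set.Ico 0 (δ₀ / Γ)))
    -- (a) analytic bound on the pressure gradient
    (ha : ∀ t ∈ Set.Ico (0 : ℝ) (δ₀ / Γ), ∀ δ ∈ Set.Ico (0 : ℝ) (δ₀ - Γ * t),
      ∑' k : Fin d → ℤ,
          ENNReal.ofReal (znorm k) * (‖phat t k‖₊ : ℝ≥0∞)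
            * ENNReal.ofReal (Real.exp (δ * znorm k))
        ≤ ENNReal.ofReal (C / Real.sqrt (δ₀ - δ - Γ * t)))
    -- (b) uniformly bounded analytic norms of R
    (hb : ∃ B : ℝ, ∀ t ∈ Set.Ico (0 : ℝ) (δ₀ / Γ), ∀ δ ∈ Set.Ico (0 : ℝ) (δ₀ - Γ * t),
      ∑' n : Fin d → ℤ,
          (‖Rhat t n‖₊ : ℝ≥0∞) * ENNReal.ofReal (Real.exp (δ * znorm n))
        ≤ ENNReal.ofReal B)
    -- absolute convergence of the inner sums
    (hsum : ∀ n : Fin d → ℤ, ∀ τ ∈ Set.Ico (0 : ℝ) (δ₀ / Γ),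
      Summable fun k : Fin d → ℤ =>
        ‖(((∑ j, n j * k j : ℤ)) : ℂ) * phat τ k * Rhat τ (n - k)‖)
    -- (c) Duhamel identity
    (hc : ∀ n : Fin d → ℤ, ∀ t ∈ Set.Ico (0 : ℝ) (δ₀ / Γ),
      Rhat t n = -∫ s in (0 : ℝ)..t, ∫ τ in (0 : ℝ)..s,
        ∑' k : Fin d → ℤ, (((∑ j, n j * k j : ℤ)) : ℂ) * phat τ k * Rhat τ (n - k)) :
    ∀ n : Fin d → ℤ, ∀ t ∈ Set.Ico (0 : ℝ) (δ₀ / Γ), Rhat t n = 0 := by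
  obtain ⟨B, hb⟩ := hb
  set c : ℝ := C * ((Γ / 2) * √(Γ / 2))⁻¹
  have hc0 : 0 < c := by positivity
  set q : ℝ := √(1 / (32 * c)) with hqdef
  have hq : 0 < q := Real.sqrt_pos.2 (by positivity)
  have hqc : 16 * c * q ^ 2 ≤ 1 / 2 := by
    rw [hqdef, Real.sq_sqrt (by positivity)]
    exact le_of_eq (by field_simp; norm_num)
  have hvanish (N : ℕ) : ∀ t ∈ Set.Ico (0 : ℝ) (δ₀ / Γ), t < N * q ^ 4 → ∀ n, Rhat t n = 0 := by
    induction N with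
    | zero =>
      intro t ht hlt
      simp only [Nat.cast_zero, zero_mul] at hlt
      exact absurd ht.1 hlt.not_ge
    | succ N ih =>
      rw [Nat.cast_succ, add_one_mul]
      exact eq_zero_of_lt_add hΓ hC hq.le hqc phat Rhat ha hb hc ih
  intro n t ht
  obtain ⟨N, hN⟩ := exists_nat_gt (t / q ^ 4)
  exact hvanish N t ht ((div_lt_iff₀ (by positivity)).1 hN) n
end
end

section
/- Let μ be a Borel probability measure on ℝ^d with ∫‖w‖ dμ(w) < ∞, let n ∈ ℤ^d with n ≠ 0, let r > 0, φ ∈ ℝ and c ∈ ℝ, set λ := |n|(r + iφ) and u := n/|n|, and assume the Penrose condition for the kinetic Euler equation ∫ dμ(w)/(λ + i n·w)² = 0. Set θ(w) := arctan((φ + u·w)/r) and define, for x ∈ ℝ^d and w ∈ ℝ^d: r₀(x,w) := −c·cos(n·x − 2θ(w))/(r² + (φ + u·w)²), u₀(x,w) := c·sin(n·x − θ(w))/√(r² + (φ + u·w)²) · u ∈ ℝ^d, V(x) := −(c²/2)·( ∫ sin(2 n·x − 3θ(w))/(r² + (φ + u·w)²)^{3/2} dμ(w) )·u ∈ ℝ^d,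 and ũ₀(x,w) := u₀(x,w) − V(x). Then: (i) for every x ∈ ℝ^d, ∫ r₀(x,w) dμ(w) = 0; and (ii) the vector field x ↦ ∫ (1 + r₀(x,w))·(w + ũ₀(x,w)) dμ(w) has identically zero divergence on ℝ^d. Consequently the modified initial data (1 + r₀, w + ũ₀) satisfy the incompressibility and zero-macroscopic-divergence constraints required of initial data for the kinetic Euler equation. -/
open MeasureTheory Complex

noncomputable section

/-- Scalar product `n·w` of `n ∈ ℤ^d` with `w ∈ ℝ^d`. -/
def zdot {d : ℕ} (n : Fin d → ℤ) (w : Fin d → ℝ) : ℝ := ∑ j, (n j : ℝ) * w j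

/-- A bounded continuous function is integrable for a finite measure. -/
lemma integrable_of_continuous_of_abs_le {X : Type*} [TopologicalSpace X] [MeasurableSpace X]
    [OpensMeasurableSpace X] {μ : Measure X} [IsFiniteMeasure μ]
    {f : X → ℝ} (hf : Continuous f) (B : ℝ) (hB : ∀ w, |f w| ≤ B) : Integrable f μ :=
  Integrable.of_bound hf.measurable.aestronglyMeasurable B (Filter.Eventually.of_forall hB)

lemma abs_div_le_one_div {x y b : ℝ} (hx : |x| ≤ 1) (hb : 0 < b) (hby : b ≤ y) :
    |x / y| ≤ 1 / b := by
  rw [abs_div, abs_of_pos (hb.trans_le hby)]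
  exact div_le_div₀ zero_le_one hx hb hby

lemma cos_two_arctan_div {r : ℝ} (hr : 0 < r) (a : ℝ) :
    Real.cos (2 * Real.arctan (a / r)) = (r ^ 2 - a ^ 2) / (r ^ 2 + a ^ 2) := by
  have h : 0 < r ^ 2 + a ^ 2 := by positivity
  have h1 : 1 + (a / r) ^ 2 = (r ^ 2 + a ^ 2) / r ^ 2 := by field_simp
  rw [Real.cos_two_mul, Real.cos_sq_arctan, h1]
  field_simp
  ring

lemma cos_arctan_div {r : ℝ} (hr : 0 < r) (a : ℝ) :
    Real.cos (Real.arctan (a / r)) = r / Real.sqrt (r ^ 2 + a ^ 2) := by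
  have h1 : 1 + (a / r) ^ 2 = (r ^ 2 + a ^ 2) / r ^ 2 := by field_simp
  rw [Real.cos_arctan, h1, Real.sqrt_div (by positivity), Real.sqrt_sq hr.le, one_div_div]

lemma sin_arctan_div {r : ℝ} (hr : 0 < r) (a : ℝ) :
    Real.sin (Real.arctan (a / r)) = a / Real.sqrt (r ^ 2 + a ^ 2) := by
  have h1 : 1 + (a / r) ^ 2 = (r ^ 2 + a ^ 2) / r ^ 2 := by field_simp
  rw [Real.sin_arctan, h1, Real.sqrt_div (by positivity), Real.sqrt_sq hr.le]
  field_simp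

lemma sin_two_arctan_div {r : ℝ} (hr : 0 < r) (a : ℝ) :
    Real.sin (2 * Real.arctan (a / r)) = 2 * a * r / (r ^ 2 + a ^ 2) := by
  have h : 0 < r ^ 2 + a ^ 2 := by positivity
  rw [Real.sin_two_mul, cos_arctan_div hr, sin_arctan_div hr, mul_assoc, div_mul_div_comm,
    Real.mul_self_sqrt h.le]
  ring

/-- Polar form of the inverse square of `r + i a`. -/
lemma one_div_sq_eq_polar {r : ℝ} (hr : 0 < r) (a : ℝ) :
    1 / ((r : ℂ) + I * (a : ℂ)) ^ 2
      = ((Real.cos (2 * Real.arctan (a / r)) / (r ^ 2 + a ^ 2) : ℝ) : ℂ)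
        - I * ((Real.sin (2 * Real.arctan (a / r)) / (r ^ 2 + a ^ 2) : ℝ) : ℂ) := by
  have h : 0 < r ^ 2 + a ^ 2 := by positivity
  have hprod : ((r : ℂ) + I * a) * ((r : ℂ) - I * a) = ((r ^ 2 + a ^ 2 : ℝ) : ℂ) := by
    push_cast
    linear_combination (-(a : ℂ) ^ 2) * I_sq
  have hD : ((r ^ 2 + a ^ 2 : ℝ) : ℂ) ≠ 0 := by exact_mod_cast h.ne'
  have hz : (r : ℂ) + I * a ≠ 0 := left_ne_zero_of_mul (hprod ▸ hD)
  rw [cos_two_arctan_div hr, sin_two_arctan_div hr, div_eq_iff (pow_ne_zero 2 hz)]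
  have e : (((r ^ 2 - a ^ 2) / (r ^ 2 + a ^ 2) / (r ^ 2 + a ^ 2) : ℝ) : ℂ)
      - I * ((2 * a * r / (r ^ 2 + a ^ 2) / (r ^ 2 + a ^ 2) : ℝ) : ℂ)
      = ((r : ℂ) - I * a) ^ 2 / ((r ^ 2 + a ^ 2 : ℝ) : ℂ) ^ 2 := by
    rw [ofReal_div, ofReal_div, ofReal_div, ofReal_div]
    field_simp
    push_cast
    linear_combination (-(a : ℂ) ^ 2) * I_sq
  rw [e, div_mul_eq_mul_div, ← mul_pow, mul_comm, hprod, div_self (pow_ne_zero 2 hD)]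

lemma rpow_three_halves {D : ℝ} (hD : 0 < D) : D ^ ((3 : ℝ) / 2) = D * Real.sqrt D := by
  rw [show (3 : ℝ) / 2 = 1 + 1 / 2 by norm_num, Real.rpow_add hD, Real.rpow_one,
    ← Real.sqrt_eq_rpow]

lemma zdot_update {d : ℕ} (n : Fin d → ℤ) (x : Fin d → ℝ) (j : Fin d) (y : ℝ) :
    zdot n (Function.update x j y) = zdot n x + n j * (y - x j) := by
  have h : Function.update x j y = x + Pi.single j (y - x j) := by
    ext i
    by_cases hi : i = j
    · subst hi; simp
    · simp [hi]
  simp [zdot, h, mul_add, Finset.sum_add_distrib, Pi.single_apply]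

lemma znorm_pos {d : ℕ} {n : Fin d → ℤ} (hn : n ≠ 0) : 0 < znorm n := by
  obtain ⟨j, hj⟩ := Function.ne_iff.mp hn
  have hj' : (n j : ℝ) ≠ 0 := by exact_mod_cast hj
  exact Real.sqrt_pos.mpr (Finset.sum_pos' (fun i _ => sq_nonneg _)
    ⟨j, Finset.mem_univ j, by positivity⟩)

lemma znorm_sq {d : ℕ} (n : Fin d → ℤ) : znorm n ^ 2 = ∑ j, (n j : ℝ) ^ 2 :=
  Real.sq_sqrt (Finset.sum_nonneg fun _ _ => sq_nonneg _)

/-- The initial data of the exponential growing mode of the linearized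
multiphasic kinetic Euler system, corrected by the quadratic vector field `V`,
satisfy the constraints required of initial data for the kinetic Euler
equation: `∫ r₀(x,w) dμ(w) = 0` and the macroscopic velocity field
`x ↦ ∫ (1+r₀)(w+ut₀) dμ(w)` is divergence free. -/
theorem stmt_19 (d : ℕ) (μ : Measure (Fin d → ℝ)) [IsProbabilityMeasure μ]
    (hμ : Integrable (fun w : Fin d → ℝ => ‖w‖) μ)
    (n : Fin d → ℤ) (hn : n ≠ 0) (r φ c : ℝ) (hr : 0 < r)
    (lam : ℂ) (hlam : lam = (znorm n : ℂ) * ((r : ℂ) + Complex.I * (φ : ℂ)))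
    (u : Fin d → ℝ) (hu : ∀ j, u j = (n j : ℝ) / znorm n)
    (hPenrose : ∫ w, 1 / (lam + Complex.I * (zdot n w : ℂ)) ^ 2 ∂μ = 0)
    (θ : (Fin d → ℝ) → ℝ) (hθ : ∀ w, θ w = Real.arctan ((φ + ∑ j, u j * w j) / r))
    (r₀ : (Fin d → ℝ) → (Fin d → ℝ) → ℝ)
    (hr₀ : ∀ x w, r₀ x w
      = -c * Real.cos (zdot n x - 2 * θ w) / (r ^ 2 + (φ + ∑ j, u j * w j) ^ 2))
    (u₀ : (Fin d → ℝ) → (Fin d → ℝ) → Fin d → ℝ)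
    (hu₀ : ∀ x w j, u₀ x w j
      = c * Real.sin (zdot n x - θ w)
          / Real.sqrt (r ^ 2 + (φ + ∑ j, u j * w j) ^ 2) * u j)
    (V : (Fin d → ℝ) → Fin d → ℝ)
    (hV : ∀ x j, V x j
      = -(c ^ 2 / 2) * (∫ w, Real.sin (2 * zdot n x - 3 * θ w)
            / (r ^ 2 + (φ + ∑ j', u j' * w j') ^ 2) ^ ((3 : ℝ) / 2) ∂μ) * u j)
    (ut₀ : (Fin d → ℝ) → (Fin d → ℝ) → Fin d → ℝ)
    (hut₀ : ∀ x w j, ut₀ x w j = u₀ x w j - V x j) :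
    -- (i) incompressibility of the initial density
    (∀ x : Fin d → ℝ, ∫ w, r₀ x w ∂μ = 0)
    -- (ii) the macroscopic velocity field is divergence free
    ∧ (∀ x : Fin d → ℝ,
        ∑ j, deriv (fun y =>
            ∫ w, (1 + r₀ (Function.update x j y) w)
              * (w j + ut₀ (Function.update x j y) w j) ∂μ) (x j) = 0) := by
  have hN := znorm_pos hn
  have hNu : ∀ j, (n j : ℝ) = znorm n * u j := fun j => by rw [hu]; field_simp
  have hnu : ∑ j, (n j : ℝ) * u j = znorm n := by
    simp_rw [hu, mul_div_assoc', ← sq, ← Finset.sum_div, ← znorm_sq]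
    field_simp
  obtain ⟨a, ha⟩ : ∃ a : (Fin d → ℝ) → ℝ, ∀ w, φ + ∑ j, u j * w j = a w := ⟨_, fun _ => rfl⟩
  have hac : Continuous a := by
    rw [show a = fun w => φ + ∑ j, u j * w j from funext fun w => (ha w).symm]
    fun_prop
  have hzdot : ∀ w, zdot n w = znorm n * (a w - φ) := fun w => by
    rw [← ha, add_sub_cancel_left, Finset.mul_sum, zdot]
    exact Finset.sum_congr rfl fun j _ => by rw [hNu]; ring
  simp only [ha] at hθ hr₀ hu₀ hV
  have hD : ∀ w, 0 < r ^ 2 + a w ^ 2 := fun w => by positivity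
  have hθc : Continuous θ := by
    rw [show θ = fun w => Real.arctan (a w / r) from funext hθ]
    exact Real.continuous_arctan.comp (hac.div_const r)
  have hDc : Continuous fun w => r ^ 2 + a w ^ 2 := by fun_prop
  have hDle : ∀ w, r ^ 2 ≤ r ^ 2 + a w ^ 2 := fun w => by nlinarith [sq_nonneg (a w)]
  have hsD : ∀ w, r ≤ Real.sqrt (r ^ 2 + a w ^ 2) := fun w => Real.le_sqrt_of_sq_le (hDle w)
  have hs0 : ∀ w, Real.sqrt (r ^ 2 + a w ^ 2) ≠ 0 := fun w => (hr.trans_le (hsD w)).ne'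
  have hDs : ∀ w, r ^ 2 * r ≤ (r ^ 2 + a w ^ 2) * Real.sqrt (r ^ 2 + a w ^ 2) := fun w =>
    mul_le_mul (hDle w) (hsD w) hr.le (hD w).le
  have hDs0 : ∀ w, (r ^ 2 + a w ^ 2) * Real.sqrt (r ^ 2 + a w ^ 2) ≠ 0 := fun w =>
    mul_ne_zero (hD w).ne' (hs0 w)
  simp only [rpow_three_halves (hD _)] at hV
  -- the integrable building blocks
  set p : (Fin d → ℝ) → ℝ := fun w => Real.cos (2 * θ w) / (r ^ 2 + a w ^ 2) with hp
  set q : (Fin d → ℝ) → ℝ := fun w => Real.sin (2 * θ w) / (r ^ 2 + a w ^ 2) with hq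
  set C : (Fin d → ℝ) → ℝ := fun w => Real.cos (θ w) / Real.sqrt (r ^ 2 + a w ^ 2) with hC
  set S : (Fin d → ℝ) → ℝ := fun w => Real.sin (θ w) / Real.sqrt (r ^ 2 + a w ^ 2) with hS
  set k : (Fin d → ℝ) → ℝ := fun w =>
    Real.sin (θ w) / ((r ^ 2 + a w ^ 2) * Real.sqrt (r ^ 2 + a w ^ 2)) with hk
  set v : ℝ → (Fin d → ℝ) → ℝ := fun s w =>
    Real.sin (2 * s - 3 * θ w) / ((r ^ 2 + a w ^ 2) * Real.sqrt (r ^ 2 + a w ^ 2)) with hv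
  have hpc : Continuous p :=
    (Real.continuous_cos.comp (by fun_prop)).div hDc fun w => (hD w).ne'
  have hqc : Continuous q :=
    (Real.continuous_sin.comp (by fun_prop)).div hDc fun w => (hD w).ne'
  have hpb : ∀ w, |p w| ≤ 1 / r ^ 2 := fun w =>
    abs_div_le_one_div (Real.abs_cos_le_one _) (by positivity) (hDle w)
  have hqb : ∀ w, |q w| ≤ 1 / r ^ 2 := fun w =>
    abs_div_le_one_div (Real.abs_sin_le_one _) (by positivity) (hDle w)
  have ip : Integrable p μ := integrable_of_continuous_of_abs_le hpc _ hpb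
  have iq : Integrable q μ := integrable_of_continuous_of_abs_le hqc _ hqb
  have iC : Integrable C μ := integrable_of_continuous_of_abs_le
    ((Real.continuous_cos.comp hθc).div hDc.sqrt hs0) _
    fun w => abs_div_le_one_div (Real.abs_cos_le_one _) hr (hsD w)
  have iS : Integrable S μ := integrable_of_continuous_of_abs_le
    ((Real.continuous_sin.comp hθc).div hDc.sqrt hs0) _
    fun w => abs_div_le_one_div (Real.abs_sin_le_one _) hr (hsD w)
  have ik : Integrable k μ := integrable_of_continuous_of_abs_le
    ((Real.continuous_sin.comp hθc).div (hDc.mul hDc.sqrt) hDs0) _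
    fun w => abs_div_le_one_div (Real.abs_sin_le_one _) (by positivity) (hDs w)
  have iv : ∀ s, Integrable (v s) μ := fun s => integrable_of_continuous_of_abs_le
    ((Real.continuous_sin.comp (by fun_prop)).div (hDc.mul hDc.sqrt) hDs0) _
    fun w => abs_div_le_one_div (Real.abs_sin_le_one _) (by positivity) (hDs w)
  have iw : ∀ j, Integrable (fun w : Fin d → ℝ => w j) μ := fun j =>
    hμ.mono' (measurable_pi_apply j).aestronglyMeasurable
      (Filter.Eventually.of_forall fun w => norm_le_pi_norm w j)
  have ipw : ∀ j, Integrable (fun w => p w * w j) μ := fun j =>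
    (iw j).bdd_mul hpc.aestronglyMeasurable (Filter.Eventually.of_forall hpb)
  have iqw : ∀ j, Integrable (fun w => q w * w j) μ := fun j =>
    (iw j).bdd_mul hqc.aestronglyMeasurable (Filter.Eventually.of_forall hqb)
  -- the Penrose condition in real form
  have hPen : (∫ w, p w ∂μ) = 0 ∧ (∫ w, q w ∂μ) = 0 := by
    have e : ∀ w, 1 / (lam + I * (zdot n w : ℂ)) ^ 2
        = (1 / (znorm n : ℂ) ^ 2) * ((p w : ℂ) - I * (q w : ℂ)) := fun w => by
      have e1 : lam + I * (zdot n w : ℂ) = (znorm n : ℂ) * ((r : ℂ) + I * (a w : ℂ)) := by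
        rw [hlam, hzdot]; push_cast; ring
      rw [e1, mul_pow, ← one_div_mul_one_div, one_div_sq_eq_polar hr]
      simp only [hp, hq, hθ]
    have hN' : (1 / (znorm n : ℂ) ^ 2) ≠ 0 :=
      one_div_ne_zero (pow_ne_zero 2 (by exact_mod_cast hN.ne'))
    simp_rw [e] at hPenrose
    have ip' : Integrable (fun w => (p w : ℂ)) μ := ip.ofReal
    have iq' : Integrable (fun w => I * (q w : ℂ)) μ := iq.ofReal.const_mul I
    rw [integral_const_mul, mul_eq_zero, or_iff_right hN', integral_sub ip' iq',
      integral_const_mul, integral_complex_ofReal,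
      integral_complex_ofReal] at hPenrose
    exact ⟨by simpa using congrArg Complex.re hPenrose,
      by simpa using congrArg Complex.im hPenrose⟩
  obtain ⟨hp0, hq0⟩ := hPen
  have hr₀' : ∀ x w, r₀ x w
      = -c * Real.cos (zdot n x) * p w + -c * Real.sin (zdot n x) * q w := fun x w => by
    rw [hr₀, Real.cos_sub]; simp only [hp, hq]; ring
  have hu₀' : ∀ x w j, u₀ x w j
      = c * u j * Real.sin (zdot n x) * C w - c * u j * Real.cos (zdot n x) * S w :=
    fun x w j => by
      rw [hu₀, Real.sin_sub]; simp only [hC, hS]; ring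
  have hru : ∀ x w j, r₀ x w * u₀ x w j = -(c ^ 2 / 2) * u j * (v (zdot n x) w + k w) :=
    fun x w j => by
      have h2 : Real.sin (2 * zdot n x - 3 * θ w) + Real.sin (θ w)
          = 2 * Real.cos (zdot n x - 2 * θ w) * Real.sin (zdot n x - θ w) := by
        have h3 := Real.sin_add (zdot n x - 2 * θ w) (zdot n x - θ w)
        have h4 := Real.sin_sub (zdot n x - θ w) (zdot n x - 2 * θ w)
        rw [show (zdot n x - 2 * θ w) + (zdot n x - θ w) = 2 * zdot n x - 3 * θ w by ring] at h3
        rw [show (zdot n x - θ w) - (zdot n x - 2 * θ w) = θ w by ring] at h4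
        rw [h3, h4]
        ring
      simp only [hv, hk]
      rw [← add_div, h2, hr₀, hu₀]
      have := hs0 w
      have := (hD w).ne'
      field_simp
  have hint : ∀ x j, ∫ w, (1 + r₀ x w) * (w j + ut₀ x w j) ∂μ
      = (∫ w, w j ∂μ) - (c ^ 2 / 2) * u j * (∫ w, k w ∂μ)
        + Real.cos (zdot n x) * (-c * (∫ w, p w * w j ∂μ) - c * u j * ∫ w, S w ∂μ)
        + Real.sin (zdot n x) * (-c * (∫ w, q w * w j ∂μ) + c * u j * ∫ w, C w ∂μ) := by
    intro x j
    have e : ∀ w, (1 + r₀ x w) * (w j + ut₀ x w j)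
        = w j + (-c * Real.cos (zdot n x)) * (p w * w j)
          + (-c * Real.sin (zdot n x)) * (q w * w j)
          + (c * u j * Real.sin (zdot n x)) * C w + (-(c * u j * Real.cos (zdot n x))) * S w
          + (-(c ^ 2 / 2) * u j) * v (zdot n x) w + (-(c ^ 2 / 2) * u j) * k w
          + (c * Real.cos (zdot n x) * V x j) * p w
          + (c * Real.sin (zdot n x) * V x j) * q w + (-V x j) := fun w => by
      rw [hut₀]
      linear_combination hru x w j + (w j - V x j) * hr₀' x w + hu₀' x w j
    simp_rw [e]
    have i1 := (iw j).fun_add ((ipw j).const_mul (-c * Real.cos (zdot n x)))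
    have i2 := i1.fun_add ((iqw j).const_mul (-c * Real.sin (zdot n x)))
    have i3 := i2.fun_add (iC.const_mul (c * u j * Real.sin (zdot n x)))
    have i4 := i3.fun_add (iS.const_mul (-(c * u j * Real.cos (zdot n x))))
    have i5 := i4.fun_add ((iv (zdot n x)).const_mul (-(c ^ 2 / 2) * u j))
    have i6 := i5.fun_add (ik.const_mul (-(c ^ 2 / 2) * u j))
    have i7 := i6.fun_add (ip.const_mul (c * Real.cos (zdot n x) * V x j))
    have i8 := i7.fun_add (iq.const_mul (c * Real.sin (zdot n x) * V x j))
    rw [integral_add i8 (integrable_const _), integral_add i7 (iq.const_mul _),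
      integral_add i6 (ip.const_mul _), integral_add i5 (ik.const_mul _),
      integral_add i4 ((iv _).const_mul _), integral_add i3 (iS.const_mul _),
      integral_add i2 (iC.const_mul _), integral_add i1 ((iqw j).const_mul _),
      integral_add (iw j) ((ipw j).const_mul _)]
    simp only [integral_const_mul, hp0, hq0, integral_const, probReal_univ, one_smul]
    rw [hV x j]
    ring
  have hzw : ∀ f : (Fin d → ℝ) → ℝ, (∀ j, Integrable (fun w => f w * w j) μ) →
      ∑ j, (n j : ℝ) * (∫ w, f w * w j ∂μ) = ∫ w, f w * zdot n w ∂μ := fun f hf => by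
    simp_rw [zdot, Finset.mul_sum, ← integral_const_mul]
    rw [← integral_finsetSum _ fun j _ => (hf j).const_mul _]
    refine integral_congr_ae (Filter.Eventually.of_forall fun w => ?_)
    exact Finset.sum_congr rfl fun j _ => by ring
  have hC' : ∀ w, C w = r / (r ^ 2 + a w ^ 2) := fun w => by
    simp only [hC]
    rw [hθ, cos_arctan_div hr, div_div, Real.mul_self_sqrt (hD w).le]
  have hS' : ∀ w, S w = a w / (r ^ 2 + a w ^ 2) := fun w => by
    simp only [hS]
    rw [hθ, sin_arctan_div hr, div_div, Real.mul_self_sqrt (hD w).le]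
  have hP : ∑ j, (n j : ℝ) * (∫ w, p w * w j ∂μ) = -(znorm n * ∫ w, S w ∂μ) := by
    have e : ∀ w, p w * zdot n w
        = znorm n * r * q w - znorm n * φ * p w - znorm n * S w := fun w => by
      rw [hS', hzdot]
      simp only [hp, hq]
      rw [hθ, cos_two_arctan_div hr, sin_two_arctan_div hr]
      have := (hD w).ne'
      field_simp
      ring
    rw [hzw p ipw]
    simp_rw [e]
    rw [integral_sub (by fun_prop) (by fun_prop), integral_sub (by fun_prop) (by fun_prop)]
    simp only [integral_const_mul, hp0, hq0]
    ring
  have hQ : ∑ j, (n j : ℝ) * (∫ w, q w * w j ∂μ) = znorm n * ∫ w, C w ∂μ := by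
    have e : ∀ w, q w * zdot n w
        = znorm n * C w - znorm n * r * p w - znorm n * φ * q w := fun w => by
      rw [hC', hzdot]
      simp only [hp, hq]
      rw [hθ, cos_two_arctan_div hr, sin_two_arctan_div hr]
      have := (hD w).ne'
      field_simp
      ring
    rw [hzw q iqw]
    simp_rw [e]
    rw [integral_sub (by fun_prop) (by fun_prop), integral_sub (by fun_prop) (by fun_prop)]
    simp only [integral_const_mul, hp0, hq0]
    ring
  refine ⟨fun x => ?_, fun x => ?_⟩
  · simp_rw [hr₀']
    rw [integral_add (by fun_prop) (by fun_prop)]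
    simp only [integral_const_mul, hp0, hq0]
    ring
  · have hderiv : ∀ j, deriv (fun y => ∫ w, (1 + r₀ (Function.update x j y) w)
          * (w j + ut₀ (Function.update x j y) w j) ∂μ) (x j)
        = n j * (-Real.sin (zdot n x) * (-c * (∫ w, p w * w j ∂μ) - c * u j * ∫ w, S w ∂μ)
          + Real.cos (zdot n x) * (-c * (∫ w, q w * w j ∂μ) + c * u j * ∫ w, C w ∂μ)) := by
      intro j
      simp_rw [hint, zdot_update]
      have hs : HasDerivAt (fun y => zdot n x + n j * (y - x j)) (n j : ℝ) (x j) := by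
        simpa using (((hasDerivAt_id (x j)).sub_const (x j)).const_mul (n j : ℝ)).const_add
          (zdot n x)
      refine (((hs.cos.mul_const _).const_add _).add (hs.sin.mul_const _)).deriv.trans ?_
      simp only [sub_self, mul_zero, add_zero]
      ring
    simp_rw [hderiv]
    have e : ∀ j, (n j : ℝ) *
        (-Real.sin (zdot n x) * (-c * (∫ w, p w * w j ∂μ) - c * u j * ∫ w, S w ∂μ)
          + Real.cos (zdot n x) * (-c * (∫ w, q w * w j ∂μ) + c * u j * ∫ w, C w ∂μ))
        = c * Real.sin (zdot n x) * ((n j : ℝ) * ∫ w, p w * w j ∂μ)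
          - c * Real.cos (zdot n x) * ((n j : ℝ) * ∫ w, q w * w j ∂μ)
          + (c * Real.sin (zdot n x) * (∫ w, S w ∂μ) + c * Real.cos (zdot n x) * ∫ w, C w ∂μ)
            * ((n j : ℝ) * u j) := fun j => by ring
    simp_rw [e]
    rw [Finset.sum_add_distrib, Finset.sum_sub_distrib, ← Finset.mul_sum, ← Finset.mul_sum,
      ← Finset.mul_sum, hP, hQ, hnu]
    ring
end
end
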